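/- Let φ : R → S be a homomorphism of commutative rings. Then for every S-module M the action map α_M : S ⊗_R M → M, s ⊗ m ↦ s • m, is bijective and Tor_i^R(S, M) = 0 for all i ≥ 1 if and only if the functor D(φ) : D(S) → D(R) between unbounded derived categories induced by restriction of scalars is fully faithful. -/

import Mathlib

/-!
Homological epimorphisms of rings (Geigle–Lenzing).
`φ : R →+* S`; every `S`-module is an `R`-module by restriction of scalars.
-/

universe w u

open CategoryTheory Limits DerivedCategory

noncomputable section

namespace RingHomEpi

variable {R S : Type u} [CommRing R] [CommRing S] (φ : R →+* S)

instance : (ModuleCat.restrictScalars.{u} φ).Additive where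
  map_add := rfl

/-- `S` regarded as an `R`-module via `φ`. -/
abbrev SasR : ModuleCat.{u} R := (ModuleCat.restrictScalars φ).obj (ModuleCat.of S S)

/-- The canonical map `η_M : M → Hom_R(S, M)`, `m ↦ (s ↦ s • m)`. -/
def etaMap (M : ModuleCat.{u} S) :
    M → (SasR φ →ₗ[R] (ModuleCat.restrictScalars φ).obj M) := fun m =>
  { toFun := fun s => (show S from s) • (show M from m)
    map_add' := fun s t => add_smul (show S from s) (show S from t) (show M from m)
    map_smul' := fun r s => by
      show (φ r • (show S from s)) • (show M from m) =
        φ r • ((show S from s) • (show M from m))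
      exact smul_assoc (φ r) (show S from s) (show M from m) }

/-- The action of `S` on an `S`-module `M`, as an `R`-bilinear map. -/
def actionBilin (M : ModuleCat.{u} S) :
    SasR φ →ₗ[R]
      ((ModuleCat.restrictScalars φ).obj M →ₗ[R] (ModuleCat.restrictScalars φ).obj M) where
  toFun s :=
    { toFun := fun m => (show S from s) • (show M from m)
      map_add' := fun m m' => smul_add (show S from s) (show M from m) (show M from m')
      map_smul' := fun r m => by
        show (show S from s) • (φ r • (show M from m)) =
          φ r • ((show S from s) • (show M from m))
        rw [smul_comm] }
  map_add' s t := LinearMap.ext fun m => add_smul (show S from s) (show S from t) (show M from m)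
  map_smul' r s := LinearMap.ext fun m => by
    show (φ r • (show S from s)) • (show M from m) =
      φ r • ((show S from s) • (show M from m))
    exact smul_assoc (φ r) (show S from s) (show M from m)

/-- The action map `α_M : S ⊗_R M → M`, `s ⊗ m ↦ s • m`. -/
def actionMap (M : ModuleCat.{u} S) :
    TensorProduct R (SasR φ) ((ModuleCat.restrictScalars φ).obj M) →ₗ[R]
      (ModuleCat.restrictScalars φ).obj M :=
  TensorProduct.lift (actionBilin φ M)

/-- The multiplication map `μ : S ⊗_R S → S`, `s ⊗ t ↦ s * t`. -/
def mulMap : TensorProduct R (SasR φ) (SasR φ) →ₗ[R] SasR φ :=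
  actionMap φ (ModuleCat.of S S)

/-- Restriction of scalars is compatible with the forgetful functors to abelian groups. -/
def restrictScalarsCompForget₂Iso :
    ModuleCat.restrictScalars.{u} φ ⋙ forget₂ (ModuleCat.{u} R) AddCommGrpCat ≅
      forget₂ (ModuleCat.{u} S) AddCommGrpCat :=
  NatIso.ofComponents (fun _ => Iso.refl _) (fun _ => rfl)

instance : PreservesFiniteLimits (ModuleCat.restrictScalars.{u} φ) := by
  have : PreservesFiniteLimits
      (ModuleCat.restrictScalars.{u} φ ⋙ forget₂ (ModuleCat.{u} R) AddCommGrpCat) :=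
    preservesFiniteLimits_of_natIso (restrictScalarsCompForget₂Iso φ).symm
  exact preservesFiniteLimits_of_reflects_of_preserves _
    (forget₂ (ModuleCat.{u} R) AddCommGrpCat)

instance : PreservesFiniteColimits (ModuleCat.restrictScalars.{u} φ) := by
  have : PreservesFiniteColimits
      (ModuleCat.restrictScalars.{u} φ ⋙ forget₂ (ModuleCat.{u} R) AddCommGrpCat) :=
    preservesFiniteColimits_of_natIso (restrictScalarsCompForget₂Iso φ).symm
  exact preservesFiniteColimits_of_reflects_of_preserves _
    (forget₂ (ModuleCat.{u} R) AddCommGrpCat)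

attribute [local instance] CategoryTheory.hasExt_of_hasDerivedCategory

variable [HasDerivedCategory.{w} (ModuleCat.{u} R)]
  [HasDerivedCategory.{w} (ModuleCat.{u} S)]

/-- The functor `D(φ) : D(S) → D(R)` induced by restriction of scalars along `φ`. -/
abbrev Dphi : DerivedCategory (ModuleCat.{u} S) ⥤ DerivedCategory (ModuleCat.{u} R) :=
  (ModuleCat.restrictScalars.{u} φ).mapDerivedCategory

/-- `D(φ)` commutes with the single complex functors. -/
def singleObjIso (M : ModuleCat.{u} S) :
    (Dphi φ).obj ((DerivedCategory.singleFunctor (ModuleCat.{u} S) 0).obj M) ≅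
      (DerivedCategory.singleFunctor (ModuleCat.{u} R) 0).obj
        ((ModuleCat.restrictScalars φ).obj M) :=
  (Dphi φ).mapIso
    (((SingleFunctors.evaluation _ _ 0).mapIso
      (DerivedCategory.singleFunctorsPostcompQIso (ModuleCat.{u} S))).app M)
  ≪≫ ((ModuleCat.restrictScalars.{u} φ).mapDerivedCategoryFactors.app _)
  ≪≫ DerivedCategory.Q.mapIso
      ((HomologicalComplex.singleMapHomologicalComplex
        (ModuleCat.restrictScalars.{u} φ) (ComplexShape.up ℤ) 0).app M)
  ≪≫ (((SingleFunctors.evaluation _ _ 0).mapIso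
      (DerivedCategory.singleFunctorsPostcompQIso (ModuleCat.{u} R))).symm.app _)

/-- The natural comparison map `Ext^n_S(M, M') → Ext^n_R(M, M')` induced by
restriction of scalars along `φ`. -/
def extMap {M M' : ModuleCat.{u} S} {n : ℕ} (e : Abelian.Ext M M' n) :
    Abelian.Ext ((ModuleCat.restrictScalars φ).obj M)
      ((ModuleCat.restrictScalars φ).obj M') n :=
  Abelian.Ext.homEquiv.symm
    ((singleObjIso φ M).inv ≫ (Dphi φ).map e.hom ≫
      ((Dphi φ).commShiftIso (n : ℤ)).hom.app _ ≫
      (shiftFunctor (DerivedCategory (ModuleCat.{u} R)) (n : ℤ)).map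
        (singleObjIso φ M').hom)



section ElementsQis

variable {A : Type u} [Ring A]

lemma epi_homologyMap_iff_elements {K L : CochainComplex (ModuleCat.{u} A) ℤ} (f : K ⟶ L) (i j k : ℤ)
    (hij : i + 1 = j) (hjk : j + 1 = k) :
    Epi (HomologicalComplex.homologyMap f j) ↔
      ∀ y : L.X j, L.d j k y = 0 → ∃ x : K.X j, K.d j k x = 0 ∧ ∃ z : L.X i,
        y = f.f j x + L.d i j z := by
  rw [HomologicalComplex.epi_homologyMap_iff_up_to_refinements f i j k (by simp; lia) (by simp; lia)]
  constructor
  · intro h y hy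
    obtain ⟨A', π, hπ, x₂, hx₂, y₁, h1⟩ := h (A := ModuleCat.of A A)
      (ModuleCat.ofHom (LinearMap.toSpanSingleton A _ y)) (by
        ext; simp [hy])
    obtain ⟨a, ha⟩ := (ModuleCat.epi_iff_surjective π).1 hπ 1
    refine ⟨x₂ a, by simpa using ConcreteCategory.congr_hom hx₂ a, y₁ a, ?_⟩
    have := ConcreteCategory.congr_hom h1 a
    simpa [ha] using this
  · intro h B y₂ hy₂
    have h' : ∀ b : B, ∃ x : K.X j, K.d j k x = 0 ∧ ∃ z : L.X i,
        y₂ b = f.f j x + L.d i j z := fun b => h _ (by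
          simpa using ConcreteCategory.congr_hom hy₂ b)
    choose x hx z hz using h'
    refine ⟨ModuleCat.of A (B →₀ A), ModuleCat.ofHom (Finsupp.linearCombination A id),
      ?_, ModuleCat.ofHom (Finsupp.linearCombination A x), ?_,
      ModuleCat.ofHom (Finsupp.linearCombination A z), ?_⟩
    · rw [ModuleCat.epi_iff_surjective]
      intro b
      exact ⟨Finsupp.single b 1, by simp⟩
    · ext b; simp [hx]
    · ext b; simp [hz]

lemma mono_homologyMap_iff_elements {K L : CochainComplex (ModuleCat.{u} A) ℤ} (f : K ⟶ L) (i j k : ℤ)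
    (hij : i + 1 = j) (hjk : j + 1 = k) :
    Mono (HomologicalComplex.homologyMap f j) ↔
      ∀ x : K.X j, K.d j k x = 0 → ∀ z : L.X i, f.f j x = L.d i j z →
        ∃ w : K.X i, x = K.d i j w := by
  rw [HomologicalComplex.mono_homologyMap_iff_up_to_refinements f i j k (by simp; lia) (by simp; lia)]
  constructor
  · intro h x hx z hz
    obtain ⟨A', π, hπ, x₁, h1⟩ := h (A := ModuleCat.of A A)
      (ModuleCat.ofHom (LinearMap.toSpanSingleton A _ x)) (by
        ext; simp [hx]) (ModuleCat.ofHom (LinearMap.toSpanSingleton A _ z)) (by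
        ext; simp [hz])
    obtain ⟨a, ha⟩ := (ModuleCat.epi_iff_surjective π).1 hπ 1
    refine ⟨x₁ a, ?_⟩
    have := ConcreteCategory.congr_hom h1 a
    simpa [ha] using this
  · intro h B x₂ hx₂ y₁ hy
    have h' : ∀ b : B, ∃ w : K.X i, x₂ b = K.d i j w := fun b => h _ (by
          simpa using ConcreteCategory.congr_hom hx₂ b) (y₁ b) (by
          simpa using ConcreteCategory.congr_hom hy b)
    choose z hz using h'
    refine ⟨ModuleCat.of A (B →₀ A), ModuleCat.ofHom (Finsupp.linearCombination A id),
      ?_, ModuleCat.ofHom (Finsupp.linearCombination A z), ?_⟩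
    · rw [ModuleCat.epi_iff_surjective]
      intro b
      exact ⟨Finsupp.single b 1, by simp⟩
    · ext b; simp [hz]

lemma quasiIso_iff_elements {K L : CochainComplex (ModuleCat.{u} A) ℤ} (f : K ⟶ L) :
    QuasiIso f ↔ ∀ i j k : ℤ, i + 1 = j → j + 1 = k →
      (∀ y : L.X j, L.d j k y = 0 → ∃ x : K.X j, K.d j k x = 0 ∧ ∃ z : L.X i,
        y = f.f j x + L.d i j z) ∧
      (∀ x : K.X j, K.d j k x = 0 → ∀ z : L.X i, f.f j x = L.d i j z →
        ∃ w : K.X i, x = K.d i j w) := by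
  rw [quasiIso_iff]
  simp only [quasiIsoAt_iff_isIso_homologyMap, isIso_iff_mono_and_epi]
  constructor
  · intro h i j k hij hjk
    exact ⟨(epi_homologyMap_iff_elements f i j k hij hjk).1 (h j).2,
      (mono_homologyMap_iff_elements f i j k hij hjk).1 (h j).1⟩
  · intro h j
    have := h (j-1) j (j+1) (by lia) rfl
    exact ⟨(mono_homologyMap_iff_elements f (j-1) j (j+1) (by lia) rfl).2 this.2,
      (epi_homologyMap_iff_elements f (j-1) j (j+1) (by lia) rfl).2 this.1⟩

end ElementsQis

section Tau

variable {A : Type u} [Ring A]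

/-- The submodules of the canonical truncation `τ_{≤ n} K`. -/
def tauSub (K : CochainComplex (ModuleCat.{u} A) ℤ) (n i : ℤ) : Submodule A (K.X i) where
  carrier := {x | (n ≤ i → K.d i (i+1) x = 0) ∧ (n < i → x = 0)}
  add_mem' := by
    rintro a b ⟨ha, ha'⟩ ⟨hb, hb'⟩
    exact ⟨fun h => by rw [map_add, ha h, hb h, add_zero], fun h => by rw [ha' h, hb' h, add_zero]⟩
  zero_mem' := ⟨fun _ => map_zero _, fun _ => rfl⟩
  smul_mem' := by
    rintro c x ⟨hx, hx'⟩
    exact ⟨fun h => by rw [map_smul, hx h, smul_zero], fun h => by rw [hx' h, smul_zero]⟩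

lemma tauSub_d (K : CochainComplex (ModuleCat.{u} A) ℤ) (n i j : ℤ) (x : K.X i)
    (hx : x ∈ tauSub K n i) : (K.d i j).hom x ∈ tauSub K n j := by
  refine ⟨fun _ => by rw [← ConcreteCategory.comp_apply]; simp, fun h => ?_⟩
  by_cases hij : i + 1 = j
  · subst hij
    exact hx.1 (by lia)
  · rw [K.shape i j hij]; rfl

/-- The canonical truncation `τ_{≤ n} K`. -/
def tau (K : CochainComplex (ModuleCat.{u} A) ℤ) (n : ℤ) : CochainComplex (ModuleCat.{u} A) ℤ where
  X i := ModuleCat.of A (tauSub K n i)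
  d i j := ModuleCat.ofHom ((K.d i j).hom.restrict (tauSub_d K n i j))
  shape i j hij := by
    ext x
    change (K.d i j).hom x.1 = 0
    rw [K.shape i j hij]; rfl
  d_comp_d' i j k _ _ := by
    ext x
    change (K.d j k).hom ((K.d i j).hom x.1) = 0
    rw [← ConcreteCategory.comp_apply]; simp

/-- Functoriality of `tau`. -/
def tauMap {K L : CochainComplex (ModuleCat.{u} A) ℤ} (f : K ⟶ L) {n m : ℤ} (h : n ≤ m) :
    tau K n ⟶ tau L m where
  f i := ModuleCat.ofHom ((f.f i).hom.restrict (p := tauSub K n i) (q := tauSub L m i) (by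
    rintro x ⟨hx, hx'⟩
    refine ⟨fun h1 => ?_, fun h1 => ?_⟩
    · have := ConcreteCategory.congr_hom (f.comm i (i+1)) x
      simp only [ConcreteCategory.comp_apply] at this
      rw [hx (by lia), map_zero] at this
      exact this
    · rw [hx' (by lia), map_zero]))
  comm' i j _ := by
    ext x
    apply Subtype.ext
    exact ConcreteCategory.congr_hom (f.comm i j) x.1

/-- The inclusion. -/
def tauι (K : CochainComplex (ModuleCat.{u} A) ℤ) (n : ℤ) : tau K n ⟶ K where
  f i := ModuleCat.ofHom (tauSub K n i).subtype
  comm' i j _ := rfl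

lemma tauMap_f_coe {K L : CochainComplex (ModuleCat.{u} A) ℤ} (f : K ⟶ L) {n m : ℤ} (h : n ≤ m)
    (i : ℤ) (x : (tau K n).X i) : (tauι L m).f i ((tauMap f h).f i x) = f.f i ((tauι K n).f i x) := rfl

lemma tauMap_ι {K L : CochainComplex (ModuleCat.{u} A) ℤ} (f : K ⟶ L) {n m : ℤ} (h : n ≤ m) :
    tauMap f h ≫ tauι L m = tauι K n ≫ f := rfl

lemma tauι_f_injective (K : CochainComplex (ModuleCat.{u} A) ℤ) (n i : ℤ) :
    Function.Injective ((tauι K n).f i) := Subtype.val_injective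

instance (K : CochainComplex (ModuleCat.{u} A) ℤ) (n : ℤ) : Mono (tauι K n) :=
  HomologicalComplex.mono_of_mono_f _ fun i => (ModuleCat.mono_iff_injective _).2
    (tauι_f_injective K n i)

lemma tau_ext {K : CochainComplex (ModuleCat.{u} A) ℤ} {n i : ℤ} {x y : (tau K n).X i}
    (h : (tauι K n).f i x = (tauι K n).f i y) : x = y := Subtype.ext h

lemma tau_exists {K : CochainComplex (ModuleCat.{u} A) ℤ} {n i : ℤ} (x : K.X i)
    (h : i < n ∨ (i ≤ n ∧ K.d i (i+1) x = 0)) : ∃ y : (tau K n).X i, (tauι K n).f i y = x :=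
  ⟨⟨x, fun h' => by
    obtain h | h := h
    · lia
    · exact h.2, fun h' => by lia⟩, rfl⟩

lemma tau_eq_zero {K : CochainComplex (ModuleCat.{u} A) ℤ} {n i : ℤ} (h : n < i)
    (x : (tau K n).X i) : x = 0 := tau_ext (by rw [map_zero]; exact x.2.2 h)

lemma tau_d_eq_zero {K : CochainComplex (ModuleCat.{u} A) ℤ} {n i : ℤ} (h : n ≤ i) (j : ℤ)
    (hj : i + 1 = j)
    (x : (tau K n).X i) : K.d i j ((tauι K n).f i x) = 0 := by subst hj; exact x.2.1 h

lemma tauι_d {K : CochainComplex (ModuleCat.{u} A) ℤ} {n : ℤ} (i j : ℤ) (x : (tau K n).X i) :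
    (tauι K n).f j ((tau K n).d i j x) = K.d i j ((tauι K n).f i x) := rfl

instance (K : CochainComplex (ModuleCat.{u} A) ℤ) (n : ℤ) : (tau K n).IsStrictlyLE n := by
  rw [CochainComplex.isStrictlyLE_iff]
  intro i hi
  rw [ModuleCat.isZero_iff_subsingleton]
  exact ⟨fun x y => by rw [tau_eq_zero hi x, tau_eq_zero hi y]⟩

lemma quasiIso_tauMap {K L : CochainComplex (ModuleCat.{u} A) ℤ} (f : K ⟶ L) [hf : QuasiIso f]
    (n : ℤ) : QuasiIso (tauMap f (le_refl n)) := by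
  rw [quasiIso_iff_elements] at hf ⊢
  intro i j k hij hjk
  obtain ⟨h1, h2⟩ := hf i j k hij hjk
  constructor
  · intro y hy
    by_cases hj : n < j
    · exact ⟨0, by simp, 0, by rw [tau_eq_zero hj y]; simp⟩
    have hy' : L.d j k ((tauι L n).f j y) = 0 := by rw [← tauι_d, hy, map_zero]
    obtain ⟨x, hx, z, hz⟩ := h1 _ hy'
    obtain ⟨x, rfl⟩ := tau_exists (n := n) x (Or.inr ⟨by lia, by subst hjk; exact hx⟩)
    obtain ⟨z, rfl⟩ := tau_exists (n := n) z (Or.inl (by lia))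
    exact ⟨x, tau_ext (by rw [tauι_d, hx, map_zero]), z, tau_ext (by
      rw [hz, map_add, tauι_d, tauMap_f_coe])⟩
  · intro x hx z hz
    by_cases hj : n < j
    · exact ⟨0, by rw [tau_eq_zero hj x]; simp⟩
    obtain ⟨w, hw⟩ := h2 ((tauι K n).f j x) (by rw [← tauι_d, hx, map_zero]) ((tauι L n).f i z)
      (by rw [← tauι_d, ← hz, tauMap_f_coe])
    obtain ⟨w, rfl⟩ := tau_exists (n := n) w (Or.inl (by lia))
    exact ⟨w, tau_ext (by rw [hw, tauι_d])⟩

end Tau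

section Colim

variable {A : Type u} [Ring A]

lemma quasiIso_of_isColimit (D : ℕ ⥤ CochainComplex (ModuleCat.{u} A) ℤ) (c : Cocone D)
    (hc : IsColimit c) (K : CochainComplex (ModuleCat.{u} A) ℤ) (f : c.pt ⟶ K)
    (p : ∀ n : ℕ, D.obj n ⟶ tau K n) (hp : ∀ n, QuasiIso (p n))
    (h : ∀ n, p n ≫ tauι K n = c.ι.app n ≫ f) : QuasiIso f := by
  have hpf : PreservesFilteredColimitsOfSize.{0, 0} (forget (ModuleCat.{u} A)) :=
    preservesFilteredColimitsOfSize_shrink.{0, u, 0, u} _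
  have hcj : ∀ j : ℤ, IsColimit ((HomologicalComplex.eval (ModuleCat.{u} A) (ComplexShape.up ℤ) j).mapCocone c) :=
    fun j => isColimitOfPreserves _ hc
  have h' : ∀ n j (x : (D.obj n).X j), (tauι K n).f j ((p n).f j x) = f.f j ((c.ι.app n).f j x) := by
    intro n j x
    have := congr_arg (fun g => g.f j x) (h n)
    simpa using this
  have hd : ∀ n i j (x : (D.obj n).X i), (c.ι.app n).f j ((D.obj n).d i j x) =
      c.pt.d i j ((c.ι.app n).f i x) := by
    intro n i j x
    have := ConcreteCategory.congr_hom ((c.ι.app n).comm i j) x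
    exact this.symm
  have hpd : ∀ n i j (x : (D.obj n).X i), (p n).f j ((D.obj n).d i j x) =
      (tau K n).d i j ((p n).f i x) := by
    intro n i j x
    have := ConcreteCategory.congr_hom ((p n).comm i j) x
    exact this.symm
  have hmd : ∀ n m (g : n ⟶ m) i j (x : (D.obj n).X i), (D.map g).f j ((D.obj n).d i j x) =
      (D.obj m).d i j ((D.map g).f i x) := by
    intro n m g i j x
    have := ConcreteCategory.congr_hom ((D.map g).comm i j) x
    exact this.symm
  have hw : ∀ n m (g : n ⟶ m) j (x : (D.obj n).X j), (c.ι.app m).f j ((D.map g).f j x) =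
      (c.ι.app n).f j x := by
    intro n m g j x
    have := congr_arg (fun g => g.f j x) (c.w g)
    exact this
  have rep : ∀ j (x : c.pt.X j), ∃ n, ∃ y : (D.obj n).X j, (c.ι.app n).f j y = x := by
    intro j x
    obtain ⟨n, y, hy⟩ := Concrete.isColimit_exists_rep _ (hcj j) x
    exact ⟨n, y, hy⟩
  have zero : ∀ n j (x : (D.obj n).X j), (c.ι.app n).f j x = 0 → ∃ m, ∃ g : n ⟶ m,
      (D.map g).f j x = 0 := by
    intro n j x hx
    obtain ⟨m, g, g', hg⟩ := Concrete.isColimit_exists_of_rep_eq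
      (F := D ⋙ HomologicalComplex.eval (ModuleCat.{u} A) (ComplexShape.up ℤ) j) (hcj j)
      (i := n) (j := n) x 0 (by
      refine Eq.trans hx ?_
      symm; exact map_zero _)
    refine ⟨m, g, ?_⟩
    refine Eq.trans hg ?_
    exact map_zero _
  rw [quasiIso_iff_elements]
  simp only [quasiIso_iff_elements] at hp
  intro i j k hij hjk
  constructor
  · intro y hy
    let n := j.toNat
    obtain ⟨y, rfl⟩ := tau_exists (n := (n : ℤ)) y (Or.inr ⟨by lia, by subst hjk; exact hy⟩)
    obtain ⟨x, hx, z, hz⟩ := (hp n i j k hij hjk).1 y (tau_ext (by rw [tauι_d, hy, map_zero]))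
    refine ⟨(c.ι.app n).f j x, ?_, (tauι K n).f i z, ?_⟩
    · rw [← hd, hx, map_zero]
    · rw [hz, map_add, h', tauι_d]
  · intro x hx z hz
    obtain ⟨n, x, rfl⟩ := rep _ x
    obtain ⟨m, g, hg⟩ := zero n k ((D.obj n).d j k x) (by rw [hd, hx])
    let N := max m j.toNat
    let g' : n ⟶ N := g ≫ homOfLE (le_max_left _ _)
    have hg' : (D.obj N).d j k ((D.map g').f j x) = 0 := by
      rw [← hmd]
      simp only [g', D.map_comp, HomologicalComplex.comp_f, ConcreteCategory.comp_apply, hg, map_zero]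
    have hN : j ≤ (N : ℤ) := by simp [N]
    obtain ⟨z, rfl⟩ := tau_exists (n := (N : ℤ)) z (Or.inl (by lia))
    obtain ⟨w, hw'⟩ := (hp N i j k hij hjk).2 _ hg' z (tau_ext (by
      rw [h', hw, hz, tauι_d]))
    refine ⟨(c.ι.app N).f i w, ?_⟩
    rw [← hd, ← hw', hw]

end Colim

section Factor

open Opposite

variable {C : Type*} [Category* C] [Abelian C]

lemma quasiIso_of_opEquivalence {K L : CochainComplex C ℤ} (f : K ⟶ L)
    (h : QuasiIso ((CochainComplex.opEquivalence C).functor.map f.op)) : QuasiIso f := by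
  rw [quasiIso_iff] at h ⊢
  intro j
  obtain ⟨i, hi⟩ : ∃ i, i = - j := ⟨_, rfl⟩
  obtain rfl : j = - i := by lia
  rw [quasiIsoAt_iff' _ (-(i + 1)) (- i) (-(i - 1)) (by simp; lia) (by simp; lia)]
  have h' := h i
  rw [quasiIsoAt_iff' _ (i - 1) (i) (i + 1) (by simp) (by simp)] at h'
  rw [← ShortComplex.quasiIso_opMap_iff]
  exact h'

lemma injective_of_epiWithInjectiveKernel {X Y : C} (g : X ⟶ Y)
    (h : Abelian.epiWithInjectiveKernel g) [Injective Y] : Injective X := by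
  rw [Abelian.epiWithInjectiveKernel_iff] at h
  obtain ⟨I, hI, f, w, ⟨s⟩⟩ := h
  refine ⟨fun {A B} a b hb => ⟨Injective.factorThru (a ≫ s.r) b ≫ f + Injective.factorThru (a ≫ g) b ≫ s.s, ?_⟩⟩
  have := s.id
  dsimp at this
  simp only [Preadditive.comp_add, ← Category.assoc, Injective.comp_factorThru]
  simp only [Category.assoc, ← Preadditive.comp_add, this, Category.comp_id]

lemma exists_factorization [EnoughProjectives C] {A B : CochainComplex C ℤ} (f : A ⟶ B)
    (hA : ∃ n : ℤ, A.IsStrictlyLE n) (hB : ∃ n : ℤ, B.IsStrictlyLE n)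
    (hA' : ∀ n, Projective (A.X n)) :
    ∃ (P : CochainComplex C ℤ) (_ : ∃ n : ℤ, P.IsStrictlyLE n) (_ : ∀ n, Projective (P.X n))
      (a : A ⟶ P) (p : P ⟶ B), QuasiIso p ∧ a ≫ p = f := by
  obtain ⟨n₁, hn₁⟩ := hA
  obtain ⟨n₂, hn₂⟩ := hB
  let U := (CochainComplex.opEquivalence C).functor
  let m := max n₁ n₂
  have : (U.obj (op A)).IsStrictlyGE (- (m + 1)) := by
    rw [CochainComplex.isStrictlyGE_iff]
    intro i hi
    exact (A.isZero_of_isStrictlyLE n₁ (-i) (by lia)).op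
  have : (U.obj (op B)).IsStrictlyGE (- (m + 1) + 1) := by
    rw [CochainComplex.isStrictlyGE_iff]
    intro i hi
    exact (B.isZero_of_isStrictlyLE n₂ (-i) (by lia)).op
  obtain ⟨K, hK, ι, π, _, _, hπ, fac⟩ :=
    CochainComplex.Plus.modelCategoryQuillen.cm5a (U.map f.op) (- (m + 1))
  let P := (U.objPreimage K).unop
  let e : U.obj (op P) ≅ K := U.objObjPreimageIso K
  obtain ⟨p, hp⟩ := U.map_surjective (ι ≫ e.inv)
  obtain ⟨a, ha⟩ := U.map_surjective (e.hom ≫ π)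
  have hz : ∀ i, Injective (K.X i) := fun i => by
    have : Injective ((U.obj (op A)).X i) := inferInstanceAs (Injective (op (A.X (-i))))
    exact injective_of_epiWithInjectiveKernel _ (hπ i)
  have hei : ∀ i, op (P.X (-i)) ≅ K.X i := fun i => (HomologicalComplex.eval _ _ i).mapIso e
  refine ⟨P, ⟨m + 1, ?_⟩, fun n => ?_, a.unop, p.unop, ?_, ?_⟩
  · rw [CochainComplex.isStrictlyLE_iff]
    intro i hi
    obtain ⟨i, rfl⟩ : ∃ j, i = - j := ⟨-i, by simp⟩
    exact (((K.isZero_of_isStrictlyGE (-(m+1)) i (by lia))).of_iso (hei i)).unop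
  · obtain ⟨i, rfl⟩ : ∃ j, n = - j := ⟨-n, by simp⟩
    have := hz i
    have : Injective (op (P.X (-i))) := Injective.of_iso (hei i).symm inferInstance
    exact Injective.projective_iff_injective_op.2 this
  · apply quasiIso_of_opEquivalence
    change QuasiIso (U.map p)
    rw [hp]
    infer_instance
  · apply Quiver.Hom.op_inj
    apply U.map_injective
    change U.map (p ≫ a) = _
    rw [U.map_comp, hp, ha]
    simp [fac]

end Factor

section Tower

open ZeroObject

variable {A : Type u} [Ring A]

/-- A projective resolution (bounded above, termwise projective) of the canonical
truncation `τ_{≤ n} K`. -/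
structure ResolTau (K : CochainComplex (ModuleCat.{u} A) ℤ) (n : ℤ) where
  /-- the underlying complex -/
  P : CochainComplex (ModuleCat.{u} A) ℤ
  bdd : ∃ n : ℤ, P.IsStrictlyLE n
  proj : ∀ i, Projective (P.X i)
  /-- the augmentation -/
  p : P ⟶ tau K n
  qis : QuasiIso p

lemma ResolTau.exists_zero (K : CochainComplex (ModuleCat.{u} A) ℤ) (n : ℤ) :
    Nonempty (ResolTau K n) := by
  have h0 : IsZero (0 : CochainComplex (ModuleCat.{u} A) ℤ) := isZero_zero _
  have hz : ∀ i, IsZero ((0 : CochainComplex (ModuleCat.{u} A) ℤ).X i) := fun i =>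
    (HomologicalComplex.eval _ _ i).map_isZero h0
  obtain ⟨P, h1, h2, a, p, h3, _⟩ := exists_factorization (0 : 0 ⟶ tau K n)
    ⟨0, by rw [CochainComplex.isStrictlyLE_iff]; intro i _; exact hz i⟩ ⟨n, inferInstance⟩
    (fun i => (hz i).projective)
  exact ⟨⟨P, h1, h2, p, h3⟩⟩

lemma ResolTau.exists_succ {K : CochainComplex (ModuleCat.{u} A) ℤ} {n m : ℤ} (h : n ≤ m)
    (r : ResolTau K n) :
    ∃ (r' : ResolTau K m) (a : r.P ⟶ r'.P), a ≫ r'.p = r.p ≫ tauMap (𝟙 K) h := by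
  obtain ⟨P, h1, h2, a, p, h3, h4⟩ := exists_factorization (r.p ≫ tauMap (𝟙 K) h)
    r.bdd ⟨m, inferInstance⟩ r.proj
  exact ⟨⟨P, h1, h2, p, h3⟩, a, h4⟩

/-- The tower of resolutions. -/
def ResolTau.seq (K : CochainComplex (ModuleCat.{u} A) ℤ) : ∀ n : ℕ, ResolTau K n
  | 0 => (ResolTau.exists_zero K _).some
  | (n + 1) => (ResolTau.exists_succ (m := ((n + 1 : ℕ) : ℤ)) (by simp) (ResolTau.seq K n)).choose

/-- The transition maps of the tower of resolutions. -/
def ResolTau.seqMap (K : CochainComplex (ModuleCat.{u} A) ℤ) (n : ℕ) :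
    (ResolTau.seq K n).P ⟶ (ResolTau.seq K (n + 1)).P :=
  (ResolTau.exists_succ (m := ((n + 1 : ℕ) : ℤ)) (by simp) (ResolTau.seq K n)).choose_spec.choose

lemma ResolTau.seqMap_p (K : CochainComplex (ModuleCat.{u} A) ℤ) (n : ℕ) :
    ResolTau.seqMap K n ≫ (ResolTau.seq K (n + 1)).p =
      (ResolTau.seq K n).p ≫ tauMap (𝟙 K) (by simp) :=
  (ResolTau.exists_succ (m := ((n + 1 : ℕ) : ℤ)) (by simp)
    (ResolTau.seq K n)).choose_spec.choose_spec

/-- The tower of resolutions as a functor. -/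
def ResolTau.functor (K : CochainComplex (ModuleCat.{u} A) ℤ) :
    ℕ ⥤ CochainComplex (ModuleCat.{u} A) ℤ := Functor.ofSequence (ResolTau.seqMap K)

/-- The augmentation of the tower of resolutions. -/
def ResolTau.cocone (K : CochainComplex (ModuleCat.{u} A) ℤ) : Cocone (ResolTau.functor K) where
  pt := K
  ι := NatTrans.ofSequence (fun n => (ResolTau.seq K n).p ≫ tauι K n) (fun n => by
    have h1 : (ResolTau.functor K).map (homOfLE n.le_succ) = ResolTau.seqMap K n :=
      Functor.ofSequence_map_homOfLE_succ _ n
    have h2 : ResolTau.seqMap K n ≫ ((ResolTau.seq K (n + 1)).p ≫ tauι K ((n + 1 : ℕ) : ℤ)) =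
        (ResolTau.seq K n).p ≫ tauι K n := by
      rw [← Category.assoc, ResolTau.seqMap_p, Category.assoc, tauMap_ι, Category.comp_id]
    refine Eq.trans ?_ (h2.trans (Category.comp_id _).symm)
    rw [h1]; rfl)

end Tower

section Bridge

variable {U V W : Type u} [AddCommGroup U] [AddCommGroup V] [AddCommGroup W]
  [Module R U] [Module R V] [Module R W]

lemma exact_iff_dual (a : U →ₗ[R] V) (b : V →ₗ[R] W) (hab : ∀ x, b (a x) = 0) :
    Function.Exact a b ↔ ∀ χ : CharacterModule V, (∀ u, χ (a u) = 0) →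
      ∃ ψ : CharacterModule W, ∀ v, ψ (b v) = χ v := by
  constructor
  · intro h χ hχ
    have hker : b.toAddMonoidHom.ker ≤ AddMonoidHom.ker (show V →+ AddCircle (1 : ℚ) from χ) := by
      intro v hv
      obtain ⟨u, rfl⟩ := (h v).1 hv
      exact hχ u
    let χ' : CharacterModule (V ⧸ LinearMap.ker b) :=
      QuotientAddGroup.lift _ (show V →+ AddCircle (1 : ℚ) from χ) hker
    let b' : (V ⧸ LinearMap.ker b) →ₗ[R] W := (LinearMap.ker b).liftQ b le_rfl
    have hb' : Function.Injective b' := by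
      rw [← LinearMap.ker_eq_bot]
      exact Submodule.ker_liftQ_eq_bot _ _ _ le_rfl
    obtain ⟨ψ, hψ⟩ := CharacterModule.dual_surjective_of_injective b' hb' χ'
    refine ⟨ψ, fun v => ?_⟩
    have := DFunLike.congr_fun hψ (Submodule.Quotient.mk v)
    exact this
  · intro h v
    refine ⟨fun hv => ?_, ?_⟩
    · by_contra hv'
      have hne : (LinearMap.range a).mkQ v ≠ 0 := by
        intro h0
        exact hv' ((Submodule.Quotient.mk_eq_zero _).1 h0)
      obtain ⟨c, hc⟩ := CharacterModule.exists_character_apply_ne_zero_of_ne_zero hne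
      obtain ⟨ψ, hψ⟩ := h (CharacterModule.dual (LinearMap.range a).mkQ c) (fun u => by
        change c ((LinearMap.range a).mkQ (a u)) = 0
        have : (LinearMap.range a).mkQ (a u) = 0 :=
          (Submodule.Quotient.mk_eq_zero _).2 ⟨u, rfl⟩
        rw [this, map_zero])
      apply hc
      have := hψ v
      rw [hv, map_zero] at this
      exact this.symm
    · rintro ⟨u, rfl⟩
      exact hab u

lemma lTensor_exact_iff (B : Type u) [AddCommGroup B] [Module R B] (a : U →ₗ[R] V)
    (b : V →ₗ[R] W) (hab : b ∘ₗ a = 0) :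
    Function.Exact (a.lTensor B) (b.lTensor B) ↔
      ∀ h : V →ₗ[R] CharacterModule B, h ∘ₗ a = 0 → ∃ k : W →ₗ[R] CharacterModule B,
        k ∘ₗ b = h := by
  rw [← LinearMap.rTensor_exact_iff_lTensor_exact, exact_iff_dual _ _ (fun x => by
    rw [← LinearMap.comp_apply, ← LinearMap.rTensor_comp, hab]; simp)]
  constructor
  · intro H h hh
    obtain ⟨ψ, hψ⟩ := H (CharacterModule.uncurry h) (fun u => by
      induction u with
      | zero => rw [map_zero, map_zero]
      | add x y hx hy => rw [map_add, map_add, hx, hy, add_zero]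
      | tmul x y =>
        have : h (a x) = 0 := DFunLike.congr_fun hh x
        change h (a x) y = 0
        rw [this]; rfl)
    refine ⟨CharacterModule.curry ψ, ?_⟩
    ext v t
    exact hψ (v ⊗ₜ t)
  · intro H χ hχ
    obtain ⟨k, hk⟩ := H (CharacterModule.curry χ) (by
      ext u t
      exact hχ (u ⊗ₜ t))
    refine ⟨CharacterModule.uncurry k, fun v => ?_⟩
    induction v with
    | zero => rw [map_zero, map_zero, map_zero]
    | add x y hx hy => rw [map_add, map_add, hx, hy, map_add]
    | tmul x y =>
      have := DFunLike.congr_fun (DFunLike.congr_fun hk x) y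
      exact this

lemma exact_tensor_iff (B : ModuleCat.{u} R) (T : ShortComplex (ModuleCat.{u} R)) :
    (T.map ((MonoidalCategory.tensoringLeft (ModuleCat.{u} R)).obj B)).Exact ↔
      ∀ h : T.X₂ ⟶ ModuleCat.of R (CharacterModule B), T.f ≫ h = 0 →
        ∃ k : T.X₃ ⟶ ModuleCat.of R (CharacterModule B), T.g ≫ k = h := by
  rw [ShortComplex.ShortExact.moduleCat_exact_iff_function_exact]
  refine (lTensor_exact_iff B T.f.hom T.g.hom (by
    rw [← ModuleCat.hom_comp, T.zero]; rfl)).trans ?_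
  constructor
  · intro H h hh
    obtain ⟨k, hk⟩ := H h.hom (by rw [← ModuleCat.hom_comp, hh]; rfl)
    exact ⟨ModuleCat.ofHom k, by ext : 1; exact hk⟩
  · intro H h hh
    obtain ⟨k, hk⟩ := H (ModuleCat.ofHom h) (by ext : 1; exact hh)
    exact ⟨k.hom, by rw [← ModuleCat.hom_comp, hk]; rfl⟩

lemma isZero_tor_iff (B N : ModuleCat.{u} R) (n : ℕ) :
    IsZero (((Tor (ModuleCat.{u} R) (n + 1)).obj B).obj N) ↔
      Subsingleton (Abelian.Ext.{w} N (ModuleCat.of R (CharacterModule B)) (n + 1)) := by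
  let P : ProjectiveResolution N := ProjectiveResolution.of N
  have h1 : IsZero (((Tor (ModuleCat.{u} R) (n + 1)).obj B).obj N) ↔
      ((P.complex.sc' (n + 2) (n + 1) n).map
        ((MonoidalCategory.tensoringLeft (ModuleCat.{u} R)).obj B)).Exact := by
    refine (P.isoLeftDerivedObj _ (n + 1)).isZero_iff.trans ?_
    refine (HomologicalComplex.exactAt_iff_isZero_homology _ _).symm.trans ?_
    rw [HomologicalComplex.exactAt_iff' _ (n + 2) (n + 1) n (by simp) (by simp)]
    rfl
  rw [h1, exact_tensor_iff]
  constructor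
  · intro H
    refine subsingleton_of_forall_eq 0 fun e => ?_
    obtain ⟨f, hf, rfl⟩ := P.extMk_surjective e (n + 2) rfl
    exact (ProjectiveResolution.extMk_eq_zero_iff.{w} P f (n + 2) rfl hf n rfl).2 (H f hf)
  · intro H h hh
    exact (ProjectiveResolution.extMk_eq_zero_iff.{w} P h (n + 2) rfl hh n rfl).1 (H.elim _ _)

end Bridge

section LemmaB

lemma quasiIso_iff_acyclic_cone {C : Type*} [Category* C] [Abelian C] {K L : CochainComplex C ℤ}
    (f : K ⟶ L) : QuasiIso f ↔ (CochainComplex.mappingCone f).Acyclic := by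
  rw [← HomotopyCategory.quotient_obj_mem_subcategoryAcyclic_iff_acyclic,
    ← HomologicalComplex.mem_quasiIso_iff,
    ← HomotopyCategory.quotient_map_mem_quasiIso_iff,
    HomotopyCategory.quasiIso_eq_trW_subcategoryAcyclic]
  exact ObjectProperty.trW_iff_of_distinguished _ _
    (HomotopyCategory.mappingCone_triangleh_distinguished f)

variable {C : Type*} [Category* C] [Abelian C] [HasExt.{w} C]

/-- The short complex `Z^j → C^j → Z^{j+1}`. -/
def cycSC (K : CochainComplex C ℤ) (j k : ℤ) : ShortComplex C :=
  ShortComplex.mk (K.iCycles j) (K.toCycles j k) (by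
    rw [← cancel_mono (K.iCycles k)]; simp)

lemma epi_toCycles {K : CochainComplex C ℤ} (hK : K.Acyclic) (j k : ℤ) (hjk : j + 1 = k) :
    Epi (K.toCycles j k) := by
  have := hK k
  obtain rfl : (ComplexShape.up ℤ).prev k = j := by simp; lia
  exact (ShortComplex.exact_iff_epi_toCycles _).1 this

lemma cycSC_shortExact {K : CochainComplex C ℤ} (hK : K.Acyclic) (j k : ℤ) (hjk : j + 1 = k) :
    (cycSC K j k).ShortExact := by
  have h1 : Epi (cycSC K j k).g := epi_toCycles hK j k hjk
  have h2 : Mono (cycSC K j k).f := inferInstanceAs (Mono (K.iCycles j))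
  refine { exact := ?_ }
  · refine (ShortComplex.exact_of_f_is_kernel _ (KernelFork.IsLimit.ofι' _ _ fun {A} a ha => ?_))
    have aux : ∀ a : A ⟶ K.X j, a ≫ K.toCycles j k = 0 → { l // l ≫ K.iCycles j = a } :=
      fun a ha => ⟨K.liftCycles a k (by simp; lia) (by
        rw [← K.toCycles_i, ← Category.assoc, ha, zero_comp]), by simp⟩
    exact aux a ha

lemma subsingleton_ext_cycles {K : CochainComplex C ℤ} (hK : K.Acyclic) (n : ℤ)
    [K.IsStrictlyLE n] (Y : C) (H : ∀ j i, Subsingleton (Abelian.Ext.{w} (K.X j) Y (i + 1))) :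
    ∀ (m : ℕ) (j : ℤ), n < j + m → ∀ i, Subsingleton (Abelian.Ext.{w} (K.cycles j) Y (i + 1)) := by
  intro m
  induction m with
  | zero =>
    intro j hj i
    have hz : IsZero (K.cycles j) :=
      IsZero.of_mono (K.iCycles j) (K.isZero_of_isStrictlyLE n j (by simpa using hj))
    have : Projective (K.cycles j) := hz.projective
    exact Abelian.Ext.subsingleton_of_projective _ _ _
  | succ m ih =>
    intro j hj i
    refine subsingleton_of_forall_eq 0 fun e => ?_
    have := ih (j + 1) (by push_cast at hj; lia) (i + 1)
    obtain ⟨x, hx⟩ := Abelian.Ext.contravariant_sequence_exact₁ (cycSC_shortExact hK j _ rfl) Y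
      (n₀ := i + 1) e (n₁ := i + 1 + 1) (by lia)
      (Subsingleton.elim (α := Abelian.Ext.{w} (K.cycles (j + 1)) Y (i + 1 + 1)) _ _)
    have hx0 : x = 0 := (H j i).elim _ _
    rw [← hx, hx0, Abelian.Ext.comp_zero]
    rfl

lemma extend_of_acyclic {K : CochainComplex C ℤ} (hK : K.Acyclic) (n : ℤ)
    [K.IsStrictlyLE n] (Y : C) (H : ∀ j i, Subsingleton (Abelian.Ext.{w} (K.X j) Y (i + 1)))
    (i j k : ℤ) (hij : i + 1 = j) (hjk : j + 1 = k) (h : K.X j ⟶ Y) (hh : K.d i j ≫ h = 0) :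
    ∃ g : K.X k ⟶ Y, K.d j k ≫ g = h := by
  have e1 := cycSC_shortExact hK j k hjk
  have e2 := cycSC_shortExact hK k _ rfl
  have := epi_toCycles hK i j hij
  have h1 : K.iCycles j ≫ h = 0 := by
    rw [← cancel_epi (K.toCycles i j), comp_zero, ← Category.assoc, K.toCycles_i, hh]
  have := e1.epi_g
  let h' : K.cycles k ⟶ Y := e1.exact.desc h h1
  have hh' : K.toCycles j k ≫ h' = h := e1.exact.g_desc h h1
  have := subsingleton_ext_cycles hK n Y H (n - k).natAbs (k + 1) (by lia) 0
  obtain ⟨x, hx⟩ := Abelian.Ext.contravariant_sequence_exact₁ e2 Y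
      (n₀ := 0) (Abelian.Ext.mk₀ h') (n₁ := 0 + 1) (by lia)
      (Subsingleton.elim (α := Abelian.Ext.{w} (K.cycles (k + 1)) Y (0 + 1)) _ _)
  obtain ⟨g, rfl⟩ := (Abelian.Ext.mk₀_bijective _ _).2 x
  rw [Abelian.Ext.mk₀_comp_mk₀] at hx
  have hx' : K.iCycles k ≫ g = h' := (Abelian.Ext.mk₀_bijective _ _).1 hx
  exact ⟨g, by rw [← hh', ← hx', ← K.toCycles_i j k]; exact Category.assoc _ _ _⟩

end LemmaB

section KFour

/-- Extension of scalars. -/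
abbrev Gx : ModuleCat.{u} R ⥤ ModuleCat.{u} S := ModuleCat.extendScalars.{u, u, u} φ

/-- Restriction of scalars. -/
abbrev Fx : ModuleCat.{u} S ⥤ ModuleCat.{u} R := ModuleCat.restrictScalars.{u} φ

/-- The adjunction. -/
abbrev adjx : Gx φ ⊣ Fx φ := ModuleCat.extendRestrictScalarsAdj.{u} φ

instance : (Gx φ).Additive := (adjx φ).left_adjoint_additive

/-- Extension of scalars on complexes. -/
abbrev Gc : CochainComplex (ModuleCat.{u} R) ℤ ⥤ CochainComplex (ModuleCat.{u} S) ℤ :=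
  (Gx φ).mapHomologicalComplex (ComplexShape.up ℤ)

/-- Restriction of scalars on complexes. -/
abbrev Fc : CochainComplex (ModuleCat.{u} S) ℤ ⥤ CochainComplex (ModuleCat.{u} R) ℤ :=
  (Fx φ).mapHomologicalComplex (ComplexShape.up ℤ)

/-- The counit on complexes. -/
def counitC (X : CochainComplex (ModuleCat.{u} S) ℤ) : (Gc φ).obj ((Fc φ).obj X) ⟶ X where
  f i := (adjx φ).counit.app (X.X i)
  comm' i j _ := ((adjx φ).counit.naturality (X.d i j)).symm

/-- The unit on complexes. -/
def unitC (X : CochainComplex (ModuleCat.{u} R) ℤ) : X ⟶ (Fc φ).obj ((Gc φ).obj X) where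
  f i := (adjx φ).unit.app (X.X i)
  comm' i j _ := ((adjx φ).unit.naturality (X.d i j)).symm

lemma counitC_naturality {X Y : CochainComplex (ModuleCat.{u} S) ℤ} (f : X ⟶ Y) :
    (Gc φ).map ((Fc φ).map f) ≫ counitC φ Y = counitC φ X ≫ f := by
  ext1 i
  exact (adjx φ).counit.naturality (f.f i)

lemma unitC_naturality {X Y : CochainComplex (ModuleCat.{u} R) ℤ} (f : X ⟶ Y) :
    f ≫ unitC φ Y = unitC φ X ≫ (Fc φ).map ((Gc φ).map f) := by
  ext1 i
  exact (adjx φ).unit.naturality (f.f i)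

lemma unitC_counitC (X : CochainComplex (ModuleCat.{u} S) ℤ) :
    unitC φ ((Fc φ).obj X) ≫ (Fc φ).map (counitC φ X) = 𝟙 _ := by
  ext1 i
  exact (adjx φ).right_triangle_components (X.X i)

/-- The adjoint of a morphism `P → F X`. -/
def adjMap {P : CochainComplex (ModuleCat.{u} R) ℤ} {X : CochainComplex (ModuleCat.{u} S) ℤ}
    (g : P ⟶ (Fc φ).obj X) : (Gc φ).obj P ⟶ X := (Gc φ).map g ≫ counitC φ X

lemma unitC_adjMap {P : CochainComplex (ModuleCat.{u} R) ℤ} {X : CochainComplex (ModuleCat.{u} S) ℤ}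
    (g : P ⟶ (Fc φ).obj X) : unitC φ P ≫ (Fc φ).map (adjMap φ g) = g := by
  rw [adjMap, Functor.map_comp, ← Category.assoc, ← unitC_naturality, Category.assoc,
    unitC_counitC, Category.comp_id]

lemma adjMap_comp {P Q : CochainComplex (ModuleCat.{u} R) ℤ}
    {X : CochainComplex (ModuleCat.{u} S) ℤ} (f : Q ⟶ P)
    (g : P ⟶ (Fc φ).obj X) : adjMap φ (f ≫ g) = (Gc φ).map f ≫ adjMap φ g := by
  simp [adjMap]

lemma adjMap_comp_map {P : CochainComplex (ModuleCat.{u} R) ℤ}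
    {X Y : CochainComplex (ModuleCat.{u} S) ℤ}
    (g : P ⟶ (Fc φ).obj X) (f : X ⟶ Y) : adjMap φ (g ≫ (Fc φ).map f) = adjMap φ g ≫ f := by
  simp [adjMap, counitC_naturality]

/-- The `S`-module of characters of `S`. -/
abbrev Ex : ModuleCat.{u} S := ModuleCat.of S (CharacterModule S)

/-- The action and Tor condition. -/
def Cond : Prop := ∀ M : ModuleCat.{u} S, Function.Bijective (actionMap φ M) ∧
      ∀ i : ℕ, 1 ≤ i →
        IsZero (((Tor (ModuleCat.{u} R) i).obj (SasR φ)).obj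
          ((ModuleCat.restrictScalars φ).obj M))

lemma isIso_counit (H : Cond φ) (M : ModuleCat.{u} S) : IsIso ((adjx φ).counit.app M) := by
  rw [ConcreteCategory.isIso_iff_bijective]
  have h : Function.Bijective (actionMap φ M) := (H M).1
  exact h

lemma isIso_counitC (H : Cond φ) (X : CochainComplex (ModuleCat.{u} S) ℤ) :
    IsIso (counitC φ X) := by
  have : ∀ i, IsIso ((counitC φ X).f i) := fun i => isIso_counit φ H (X.X i)
  exact HomologicalComplex.Hom.isIso_of_components _

lemma ext_FM (H : Cond φ) (M : ModuleCat.{u} S) (i : ℕ) :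
    Subsingleton (Abelian.Ext.{w} ((Fx φ).obj M) ((Fx φ).obj (Ex (S := S))) (i + 1)) :=
  (isZero_tor_iff (SasR φ) _ i).1 ((H M).2 (i + 1) (by lia))

lemma acyclic_Gc {K : CochainComplex (ModuleCat.{u} R) ℤ} (hK : K.Acyclic) (n : ℤ)
    [K.IsStrictlyLE n]
    (H : ∀ j i, Subsingleton (Abelian.Ext.{w} (K.X j) ((Fx φ).obj (Ex (S := S))) (i + 1))) :
    ((Gc φ).obj K).Acyclic := by
  intro j
  rw [HomologicalComplex.exactAt_iff' _ (j - 1) j (j + 1) (by simp) (by simp),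
    ShortComplex.ShortExact.moduleCat_exact_iff_function_exact]
  have key := (exact_tensor_iff (SasR φ) (K.sc' (j - 1) j (j + 1))).2 (fun h hh =>
    extend_of_acyclic hK n _ H (j - 1) j (j + 1) (by lia) rfl h hh)
  rw [ShortComplex.ShortExact.moduleCat_exact_iff_function_exact] at key
  exact key

lemma subsingleton_ext_cone {C : Type*} [Category* C] [Abelian C] [HasExt.{w} C]
    {K L : CochainComplex C ℤ} (f : K ⟶ L) (Y : C) (i : ℕ)
    (hK : ∀ j, Subsingleton (Abelian.Ext.{w} (K.X j) Y i))
    (hL : ∀ j, Subsingleton (Abelian.Ext.{w} (L.X j) Y i)) (j : ℤ) :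
    Subsingleton (Abelian.Ext.{w} ((CochainComplex.mappingCone f).X j) Y i) := by
  refine subsingleton_of_forall_eq 0 fun e => ?_
  have h := CochainComplex.mappingCone.id_X f j (j + 1) rfl
  rw [← Abelian.Ext.mk₀_id_comp e, ← h, Abelian.Ext.mk₀_add, Abelian.Ext.add_comp,
    ← Abelian.Ext.mk₀_comp_mk₀_assoc, ← Abelian.Ext.mk₀_comp_mk₀_assoc,
    (hK _).elim ((Abelian.Ext.mk₀ _).comp e (zero_add i)) 0,
    (hL _).elim ((Abelian.Ext.mk₀ _).comp e (zero_add i)) 0]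
  simp

lemma cone_isStrictlyLE {C : Type*} [Category* C] [Abelian C]
    {K L : CochainComplex C ℤ} (f : K ⟶ L) (n m : ℤ) [K.IsStrictlyLE n] [L.IsStrictlyLE m] :
    (CochainComplex.mappingCone f).IsStrictlyLE (max n m) := by
  rw [CochainComplex.isStrictlyLE_iff]
  intro j hj
  rw [IsZero.iff_id_eq_zero, ← CochainComplex.mappingCone.id_X f j (j + 1) rfl,
    (K.isZero_of_isStrictlyLE n (j + 1) (by lia)).eq_of_tgt
      ((CochainComplex.mappingCone.fst f).1.v j (j + 1) rfl) 0,
    (L.isZero_of_isStrictlyLE m j (by lia)).eq_of_tgt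
      ((CochainComplex.mappingCone.snd f).v j j _) 0]
  simp

lemma quasiIso_adjMap (H : Cond φ) {P : CochainComplex (ModuleCat.{u} R) ℤ} (n : ℤ)
    [P.IsStrictlyLE n] (hP : ∀ i, Projective (P.X i))
    {X : CochainComplex (ModuleCat.{u} S) ℤ} (m : ℤ) [X.IsStrictlyLE m]
    (g : P ⟶ (Fc φ).obj X) (hg : QuasiIso g) : QuasiIso (adjMap φ g) := by
  have := isIso_counitC φ H X
  have hX : CochainComplex.IsStrictlyLE ((Fc φ).obj X) m := by
    rw [CochainComplex.isStrictlyLE_iff]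
    intro i hi
    exact (Fx φ).map_isZero (X.isZero_of_isStrictlyLE m i hi)
  have := cone_isStrictlyLE g n m
  have hcone := acyclic_Gc φ ((quasiIso_iff_acyclic_cone g).1 hg) (max n m) (fun j i =>
    subsingleton_ext_cone.{w} g _ (i + 1) (fun j => Abelian.Ext.subsingleton_of_projective.{w} _ _ _)
      (fun j => ext_FM φ H (X.X j) i) j)
  have : QuasiIso ((Gc φ).map g) := by
    rw [quasiIso_iff_acyclic_cone]
    exact fun j => (hcone j).of_iso (CochainComplex.mappingCone.mapHomologicalComplexIso g (Gx φ))
  rw [adjMap]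
  infer_instance

end KFour

section Key

/-- Truncation commutes with restriction of scalars. -/
def tauFc (X : CochainComplex (ModuleCat.{u} S) ℤ) (n : ℤ) :
    tau ((Fc φ).obj X) n ⟶ (Fc φ).obj (tau X n) where
  f i := ModuleCat.ofHom
    (X := (tau ((Fc φ).obj X) n).X i) (Y := (Fx φ).obj ((tau X n).X i))
    { toFun := fun x => (⟨x.1, x.2⟩ : tauSub X n i)
      map_add' := fun _ _ => rfl
      map_smul' := fun _ _ => rfl }
  comm' i j _ := rfl

lemma tauFc_ι (X : CochainComplex (ModuleCat.{u} S) ℤ) (n : ℤ) :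
    tauFc φ X n ≫ (Fc φ).map (tauι X n) = tauι ((Fc φ).obj X) n := rfl

instance (X : CochainComplex (ModuleCat.{u} S) ℤ) (n : ℤ) : IsIso (tauFc φ X n) := by
  have : ∀ i, IsIso ((tauFc φ X n).f i) := fun i => by
    rw [ConcreteCategory.isIso_iff_bijective]
    refine ⟨fun x y h => ?_, fun y => ⟨⟨y.1, y.2⟩, rfl⟩⟩
    exact Subtype.ext (congr_arg (fun z : tauSub X n i => z.1) h)
  exact HomologicalComplex.Hom.isIso_of_components _

lemma key_aux (H : Cond φ) {X : CochainComplex (ModuleCat.{u} S) ℤ}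
    {Z₀ : CochainComplex (ModuleCat.{u} R) ℤ} (s : Z₀ ⟶ (Fc φ).obj X) (hs : QuasiIso s)
    (n : ℤ) (P : CochainComplex (ModuleCat.{u} R) ℤ) (hP : ∃ n : ℤ, P.IsStrictlyLE n)
    (hP' : ∀ i, Projective (P.X i)) (p : P ⟶ tau Z₀ n) (hp : QuasiIso p) :
    ∃ q : (Gc φ).obj P ⟶ tau X n, QuasiIso q ∧
      q ≫ tauι X n = adjMap φ (p ≫ tauι Z₀ n ≫ s) := by
  obtain ⟨m, hm⟩ := hP
  have := quasiIso_tauMap s n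
  have h2 : QuasiIso (tauMap s (le_refl n) ≫ tauFc φ X n) := inferInstance
  have h3 : QuasiIso (p ≫ tauMap s (le_refl n) ≫ tauFc φ X n) := inferInstance
  refine ⟨_, quasiIso_adjMap φ H m hP' n _ h3, ?_⟩
  rw [← adjMap_comp_map, Category.assoc, Category.assoc, tauFc_ι, tauMap_ι]

lemma key (H : Cond φ) {X : CochainComplex (ModuleCat.{u} S) ℤ}
    {Z₀ : CochainComplex (ModuleCat.{u} R) ℤ} (s : Z₀ ⟶ (Fc φ).obj X) (hs : QuasiIso s) :
    ∃ (Z : CochainComplex (ModuleCat.{u} R) ℤ) (t : Z ⟶ Z₀), QuasiIso t ∧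
      QuasiIso (adjMap φ (t ≫ s)) := by
  let D := ResolTau.functor Z₀
  let c := colimit.cocone D
  let hc : IsColimit c := colimit.isColimit D
  let t : c.pt ⟶ Z₀ := hc.desc (ResolTau.cocone Z₀)
  have ht : ∀ n : ℕ, c.ι.app n ≫ t = (ResolTau.seq Z₀ n).p ≫ tauι Z₀ n := fun n => hc.fac _ n
  refine ⟨c.pt, t, ?_, ?_⟩
  · exact quasiIso_of_isColimit D c hc Z₀ t (fun n => (ResolTau.seq Z₀ n).p)
      (fun n => (ResolTau.seq Z₀ n).qis) (fun n => (ht n).symm)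
  · have hG : PreservesColimitsOfSize.{0, 0} (Gx φ) := (adjx φ).leftAdjoint_preservesColimits
    have hc' : IsColimit ((Gc φ).mapCocone c) := isColimitOfPreserves (Gc φ) hc
    choose q hq hq' using fun n : ℕ => key_aux φ H s hs n _ (ResolTau.seq Z₀ n).bdd
      (ResolTau.seq Z₀ n).proj (ResolTau.seq Z₀ n).p (ResolTau.seq Z₀ n).qis
    refine quasiIso_of_isColimit (D ⋙ Gc φ) ((Gc φ).mapCocone c) hc' X _ q hq ?_
    intro n
    refine (hq' n).trans (Eq.trans ?_ (adjMap_comp φ (c.ι.app n) (t ≫ s)))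
    rw [← Category.assoc (c.ι.app n), ht]
    exact congr_arg (adjMap φ) (Category.assoc _ _ _).symm

end Key

section Forward

open Pretriangulated

lemma isIso_Dphi_Q_iff {X Y : CochainComplex (ModuleCat.{u} S) ℤ} (f : X ⟶ Y) :
    IsIso ((Dphi φ).map (Q.map f)) ↔ IsIso (Q.map f) := by
  have h1 : IsIso ((Dphi φ).map (Q.map f)) ↔ IsIso (Q.map ((Fc φ).map f)) :=
    NatIso.isIso_map_iff (Fx φ).mapDerivedCategoryFactors f
  rw [h1, isIso_Q_map_iff_quasiIso, isIso_Q_map_iff_quasiIso]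
  exact HomologicalComplex.quasiIso_map_iff_of_preservesHomology f (Fx φ)

lemma isIso_of_isIso_Dphi_map {A B : DerivedCategory (ModuleCat.{u} S)} (f : A ⟶ B)
    (hf : IsIso ((Dphi φ).map f)) : IsIso f := by
  let a := Q.objObjPreimageIso A
  let b := Q.objObjPreimageIso B
  have h1 : IsIso ((Dphi φ).map (a.hom ≫ f ≫ b.inv)) := by
    rw [Functor.map_comp, Functor.map_comp]; infer_instance
  obtain ⟨X', s, hs, g, hg⟩ := right_fac (a.hom ≫ f ≫ b.inv)
  have h2 : IsIso ((Dphi φ).map (Q.map g)) := by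
    have : Q.map g = Q.map s ≫ (a.hom ≫ f ≫ b.inv) := by rw [hg]; simp
    rw [this, Functor.map_comp]; infer_instance
  rw [isIso_Dphi_Q_iff] at h2
  have h3 : f = a.inv ≫ (inv (Q.map s) ≫ Q.map g) ≫ b.hom := by rw [← hg]; simp
  rw [h3]; infer_instance

lemma full_of_cond_aux (H : Cond φ) {X Y : CochainComplex (ModuleCat.{u} S) ℤ}
    (f : Q.obj ((Fc φ).obj X) ⟶ Q.obj ((Fc φ).obj Y)) :
    ∃ (W : CochainComplex (ModuleCat.{u} S) ℤ) (a : W ⟶ X) (b : W ⟶ Y), IsIso (Q.map a) ∧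
      Q.map ((Fc φ).map a) ≫ f = Q.map ((Fc φ).map b) := by
  obtain ⟨Z₀, s, hs, g, rfl⟩ := right_fac f
  have hs' := hs
  rw [isIso_Q_map_iff_quasiIso] at hs'
  obtain ⟨Z, t, ht, hts⟩ := key φ H s hs'
  refine ⟨_, adjMap φ (t ≫ s), adjMap φ (t ≫ g), ?_, ?_⟩
  · rwa [isIso_Q_map_iff_quasiIso]
  · have e1 := congr_arg Q.map (unitC_adjMap φ (t ≫ s))
    have e2 := congr_arg Q.map (unitC_adjMap φ (t ≫ g))
    have hFa : IsIso (Q.map ((Fc φ).map (adjMap φ (t ≫ s)))) := by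
      rw [isIso_Q_map_iff_quasiIso]
      exact (HomologicalComplex.quasiIso_map_iff_of_preservesHomology _ (Fx φ)).2 hts
    have hQt : IsIso (Q.map t) := by rwa [isIso_Q_map_iff_quasiIso]
    rw [Functor.map_comp, Functor.map_comp] at e1 e2
    have hη : IsIso (Q.map (unitC φ Z)) := by
      have : IsIso (Q.map (unitC φ Z) ≫ Q.map ((Fc φ).map (adjMap φ (t ≫ s)))) := by
        rw [e1]; infer_instance
      exact IsIso.of_isIso_comp_right _ (Q.map ((Fc φ).map (adjMap φ (t ≫ s))))
    rw [← cancel_epi (Q.map (unitC φ Z)), e2, ← Category.assoc, e1]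
    simp

lemma full_of_cond (H : Cond φ) : (Dphi φ).Full where
  map_surjective {A B} f := by
    let a := Q.objObjPreimageIso A
    let b := Q.objObjPreimageIso B
    let X := Q.objPreimage A
    let Y := Q.objPreimage B
    let eX := (Fx φ).mapDerivedCategoryFactors.app X
    let eY := (Fx φ).mapDerivedCategoryFactors.app Y
    obtain ⟨W, p, q, hp, hpq⟩ := full_of_cond_aux φ H (X := X) (Y := Y)
      (eX.inv ≫ (Dphi φ).map a.hom ≫ f ≫ (Dphi φ).map b.inv ≫ eY.hom)
    refine ⟨a.inv ≫ (inv (Q.map p) ≫ Q.map q) ≫ b.hom, ?_⟩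
    have n1 : (Dphi φ).map (Q.map p) ≫ eX.hom = _ ≫ Q.map ((Fc φ).map p) :=
      (Fx φ).mapDerivedCategoryFactors_hom_naturality p
    have n2 : (Dphi φ).map (Q.map q) ≫ eY.hom = _ ≫ Q.map ((Fc φ).map q) :=
      (Fx φ).mapDerivedCategoryFactors_hom_naturality q
    have key : (Dphi φ).map (Q.map p) ≫ (Dphi φ).map a.hom ≫ f ≫ (Dphi φ).map b.inv =
        (Dphi φ).map (Q.map q) := by
      rw [← cancel_mono eY.hom, n2, ← hpq, ← Category.assoc _ (Q.map ((Fc φ).map p)), ← n1]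
      simp
    rw [Functor.map_comp, Functor.map_comp, Functor.map_comp, ← key]
    simp only [Functor.map_inv, Category.assoc, IsIso.inv_hom_id_assoc]
    simp only [← Functor.map_comp_assoc, ← Functor.map_comp, Iso.inv_hom_id]
    rw [CategoryTheory.Functor.map_id, CategoryTheory.Functor.map_id]
    rw [Category.comp_id, Category.id_comp]

lemma faithful_of_full [(Dphi φ).Full] : (Dphi φ).Faithful where
  map_injective {A B} f₁ f₂ h := by
    rw [← sub_eq_zero] at h ⊢
    rw [← Functor.map_sub] at h
    generalize f₁ - f₂ = f at h ⊢
    obtain ⟨C, g, k, hT⟩ := distinguished_cocone_triangle f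
    have hT' := (Dphi φ).map_distinguished _ hT
    obtain ⟨r, hr⟩ := Triangle.yoneda_exact₂ _ hT' (𝟙 ((Dphi φ).obj B)) (by
      change (Dphi φ).map f ≫ _ = 0
      rw [h, zero_comp])
    obtain ⟨r, rfl⟩ := (Dphi φ).map_surjective (X := C) (Y := B) r
    have hr' : (Dphi φ).map (g ≫ r) = 𝟙 _ := by rw [Functor.map_comp]; exact hr.symm
    have : IsIso (g ≫ r) := isIso_of_isIso_Dphi_map φ _ (by rw [hr']; infer_instance)
    have h0 : f ≫ g = 0 := comp_distTriang_mor_zero₁₂ _ hT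
    rw [← cancel_mono (g ≫ r), ← Category.assoc, h0, zero_comp, zero_comp]

end Forward

section Backward

instance injective_Ex : Injective (Ex (S := S)) := by
  have : Module.Injective S (CharacterModule S) :=
    Module.Flat.iff_characterModule_injective.1 inferInstance
  exact Module.injective_object_of_injective_module S (CharacterModule S)

lemma ext_of_full [(Dphi φ).Full] (M : ModuleCat.{u} S) (n : ℕ) :
    Subsingleton (Abelian.Ext.{w} ((Fx φ).obj M) ((Fx φ).obj (Ex (S := S))) (n + 1)) := by
  refine subsingleton_of_forall_eq 0 fun e => ?_
  let iM := ((Fx φ).mapDerivedCategorySingleFunctor 0).app M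
  let iE := ((Fx φ).mapDerivedCategorySingleFunctor 0).app (Ex (S := S))
  let k := ((Dphi φ).commShiftIso ((n + 1 : ℕ) : ℤ)).app ((singleFunctor _ 0).obj (Ex (S := S)))
  obtain ⟨z, hz⟩ := (Dphi φ).map_surjective
    (X := (singleFunctor _ 0).obj M)
    (Y := (shiftFunctor _ ((n + 1 : ℕ) : ℤ)).obj ((singleFunctor _ 0).obj (Ex (S := S))))
    (iM.hom ≫ e.hom ≫ (shiftFunctor _ ((n + 1 : ℕ) : ℤ)).map iE.inv ≫ k.inv)
  have hz0 : z = 0 := by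
    have h := Abelian.Ext.eq_zero_of_injective.{w} (Abelian.Ext.homEquiv.{w}.symm z)
    have h' := congr_arg Abelian.Ext.hom h
    rw [Abelian.Ext.zero_hom] at h'
    rw [← h']
    exact (Equiv.apply_symm_apply _ _).symm
  rw [hz0, Functor.map_zero] at hz
  have h1 : e.hom ≫ (shiftFunctor _ ((n + 1 : ℕ) : ℤ)).map iE.inv ≫ k.inv = 0 := by
    rw [← cancel_epi iM.hom, ← hz, comp_zero]
  apply Abelian.Ext.ext
  rw [Abelian.Ext.zero_hom, ← cancel_mono ((shiftFunctor _ ((n + 1 : ℕ) : ℤ)).map iE.inv ≫ k.inv)]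
  exact h1.trans zero_comp.symm

lemma full_restrict [(Dphi φ).Full] : (Fx φ).Full where
  map_surjective {M N} g := by
    let iM := ((Fx φ).mapDerivedCategorySingleFunctor 0).app M
    let iN := ((Fx φ).mapDerivedCategorySingleFunctor 0).app N
    obtain ⟨z, hz⟩ := (Dphi φ).map_surjective
      (X := (singleFunctor _ 0).obj M) (Y := (singleFunctor _ 0).obj N)
      (iM.hom ≫ (singleFunctor _ 0).map g ≫ iN.inv)
    obtain ⟨h, rfl⟩ := (singleFunctor (ModuleCat.{u} S) 0).map_surjective z
    refine ⟨h, ?_⟩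
    apply (singleFunctor (ModuleCat.{u} R) 0).map_injective
    have n : (Dphi φ).map ((singleFunctor _ 0).map h) ≫ iN.hom =
      iM.hom ≫ (singleFunctor _ 0).map ((Fx φ).map h) :=
        ((Fx φ).mapDerivedCategorySingleFunctor 0).hom.naturality h
    rw [← cancel_epi iM.hom, ← n, hz]
    simp

lemma action_bijective [(Fx φ).Full] (M : ModuleCat.{u} S) :
    Function.Bijective (actionMap φ M) := by
  constructor
  · have key : ∀ (χ : CharacterModule (TensorProduct R (SasR φ) ((Fx φ).obj M)))
        (t : TensorProduct R (SasR φ) ((Fx φ).obj M)),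
        χ t = χ (TensorProduct.tmul R (show SasR φ from (1 : S)) (actionMap φ M t)) := by
      intro χ
      let g : (Fx φ).obj M →ₗ[R] CharacterModule (SasR φ) :=
        { toFun := fun m => AddMonoidHom.mk' (fun s => χ (TensorProduct.tmul R s m))
            (fun a b => by rw [TensorProduct.add_tmul, map_add])
          map_add' := fun a b => by
            ext s
            change χ _ = χ _ + χ _
            rw [TensorProduct.tmul_add, map_add]
          map_smul' := fun r m => by
            ext s
            change χ _ = χ _
            rw [← TensorProduct.smul_tmul]
            rfl }
      obtain ⟨h, hh⟩ := (Fx φ).map_surjective (X := M) (Y := Ex (S := S))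
        (ModuleCat.ofHom (X := (Fx φ).obj M) (Y := CharacterModule (SasR φ)) g)
      have hg : ∀ m : M, (show CharacterModule S from h m) = g m := fun m =>
        ConcreteCategory.congr_hom hh m
      have ev : ∀ (m : M) (s : S), (show S →+ AddCircle (1 : ℚ) from h m) s =
          χ (TensorProduct.tmul R (show SasR φ from s) (show (Fx φ).obj M from m)) := fun m s =>
        DFunLike.congr_fun (hg m) s
      have lin : ∀ (s : S) (m : M),
          χ (TensorProduct.tmul R (show SasR φ from s) (show (Fx φ).obj M from m)) =
            χ (TensorProduct.tmul R (show SasR φ from (1 : S))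
              (show (Fx φ).obj M from s • m)) := fun s m => by
        rw [← ev, ← ev]
        have e1 : (show CharacterModule S from h (s • m)) =
          s • (show CharacterModule S from h m) := h.hom.map_smul s m
        have e2 : (show S →+ AddCircle (1 : ℚ) from h (s • m)) 1 =
          (show S →+ AddCircle (1 : ℚ) from h m) (s * 1) := DFunLike.congr_fun e1 (1 : S)
        rw [e2, mul_one]
      intro t
      induction t with
      | zero => rw [map_zero, map_zero, TensorProduct.tmul_zero, map_zero]
      | add x y hx hy => rw [map_add, map_add, TensorProduct.tmul_add, map_add, hx, hy]
      | tmul s m =>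
        exact lin s m
    intro x y hxy
    rw [← sub_eq_zero]
    refine CharacterModule.eq_zero_of_character_apply fun χ => ?_
    rw [key, map_sub, hxy, sub_self, TensorProduct.tmul_zero, map_zero]
  · intro m
    refine ⟨TensorProduct.tmul R (show SasR φ from (1 : S)) m, ?_⟩
    exact one_smul S (show M from m)

lemma cond_of_full [(Dphi φ).Full] : Cond φ := by
  intro M
  have := full_restrict φ
  refine ⟨action_bijective φ M, fun i hi => ?_⟩
  obtain ⟨n, rfl⟩ : ∃ n, i = n + 1 := ⟨i - 1, by lia⟩
  exact (isZero_tor_iff (SasR φ) _ n).2 (ext_of_full φ M n)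

end Backward

/-- For a homomorphism `φ : R →+* S` of commutative rings, the action maps
`α_M : S ⊗_R M → M` are bijective with `Tor_i^R(S,M) = 0` for all `i ≥ 1` and all
`S`-modules `M`, if and only if the functor `D(φ) : D(S) → D(R)` induced by restriction of
scalars is fully faithful. -/
theorem action_bijective_and_tor_vanishing_iff_derived_fully_faithful :
    (∀ M : ModuleCat.{u} S, Function.Bijective (actionMap φ M) ∧
      ∀ i : ℕ, 1 ≤ i →
        IsZero (((Tor (ModuleCat.{u} R) i).obj (SasR φ)).obj
          ((ModuleCat.restrictScalars φ).obj M))) ↔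
    ((Dphi φ).Full ∧ (Dphi φ).Faithful) := by
  constructor
  · intro H
    have := full_of_cond φ H
    exact ⟨this, faithful_of_full φ⟩
  · rintro ⟨h, _⟩
    exact cond_of_full φ

end RingHomEpi
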